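/- Under the standing hypotheses: for every h ∈ H there exists a nonzero element x_h ∈ D_h commuting with every element of D_e. Moreover, letting C denote the centralizer of D_e in D_H: for each h ∈ H the intersection C ∩ D_h is a one-dimensional left L-vector space, C = ⊕_{h ∈ H} (C ∩ D_h), and the multiplication map D_e ⊗_L C → D_H is an isomorphism of L-algebras. -/

import Mathlib

variable {G : Type*} [Group G] [DecidableEq G] {D : Type*} [DivisionRing D]

/-- A faithful `G`-grading on `D`: a family of additive subgroups forming an internal
direct sum decomposition, multiplicative, with all components nonzero. -/
structure IsFaithfulGrading (𝒜 : G → AddSubgroup D) : Prop where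
  one_mem : (1 : D) ∈ 𝒜 1
  mul_mem : ∀ {g h : G} {x y : D}, x ∈ 𝒜 g → y ∈ 𝒜 h → x * y ∈ 𝒜 (g * h)
  isInternal : DirectSum.IsInternal 𝒜
  faithful : ∀ g, 𝒜 g ≠ ⊥

/-- `L`, the center of the identity component `D_e`, as a set. -/
def Lset (𝒜 : G → AddSubgroup D) : Set D := {x | x ∈ 𝒜 1 ∧ ∀ y ∈ 𝒜 1, x * y = y * x}

/-- The kernel of the conjugation action of `G` on `L`, as a set:
`{g ∈ G : x·l = l·x for every x ∈ D_g and every l ∈ L}`. -/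
def Hset (𝒜 : G → AddSubgroup D) : Set G := {g | ∀ x ∈ 𝒜 g, ∀ l ∈ Lset 𝒜, x * l = l * x}

/-- The identity component `D_e` as a subring of `D`. -/
def De (𝒜 : G → AddSubgroup D) (hG : IsFaithfulGrading 𝒜) : Subring D where
  carrier := 𝒜 1
  zero_mem' := zero_mem _
  one_mem' := hG.one_mem
  add_mem' := fun ha hb => add_mem ha hb
  neg_mem' := fun ha => neg_mem ha
  mul_mem' := fun ha hb => by simpa using hG.mul_mem ha hb

/-- `L`, the center of the identity component, as a subring of `D`. -/
def Lring (𝒜 : G → AddSubgroup D) (hG : IsFaithfulGrading 𝒜) : Subring D where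
  carrier := Lset 𝒜
  zero_mem' := ⟨zero_mem _, fun y _ => by rw [zero_mul, mul_zero]⟩
  one_mem' := ⟨hG.one_mem, fun y _ => by rw [one_mul, mul_one]⟩
  add_mem' := fun ha hb => ⟨add_mem ha.1 hb.1, fun y hy => by
    rw [add_mul, mul_add, ha.2 y hy, hb.2 y hy]⟩
  neg_mem' := fun ha => ⟨neg_mem ha.1, fun y hy => by rw [neg_mul, mul_neg, ha.2 y hy]⟩
  mul_mem' := fun {a b} ha hb => ⟨by simpa using hG.mul_mem ha.1 hb.1,
    fun y hy => by rw [mul_assoc, hb.2 y hy, ← mul_assoc, ha.2 y hy, mul_assoc]⟩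

lemma Lring_le_De (𝒜 : G → AddSubgroup D) (hG : IsFaithfulGrading 𝒜) :
    Lring 𝒜 hG ≤ De 𝒜 hG := fun _ hx => hx.1

/-- `dim_L D_e`, the dimension of the identity component over its center `L`. -/
noncomputable def dimLDe (𝒜 : G → AddSubgroup D) (hG : IsFaithfulGrading 𝒜) : ℕ :=
  letI : Module ↥(Lring 𝒜 hG) ↥(De 𝒜 hG) :=
    (Subring.inclusion (Lring_le_De 𝒜 hG)).toModule
  Module.finrank ↥(Lring 𝒜 hG) ↥(De 𝒜 hG)

/-- `D_N`, the sum `⊕_{n ∈ N} D_n` of the homogeneous components over a subset `N` of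
`G`, as an additive subgroup of `D`. -/
def DN (𝒜 : G → AddSubgroup D) (N : Set G) : AddSubgroup D := ⨆ g : N, 𝒜 (g : G)

lemma DN_mul_mem (𝒜 : G → AddSubgroup D) (hG : IsFaithfulGrading 𝒜) {N : Set G}
    (hN : ∀ a ∈ N, ∀ b ∈ N, a * b ∈ N) {x y : D}
    (hx : x ∈ DN 𝒜 N) (hy : y ∈ DN 𝒜 N) : x * y ∈ DN 𝒜 N := by
  refine AddSubgroup.iSup_induction (C := fun x => x * y ∈ DN 𝒜 N) _ hx ?_
    (by simp [zero_mem]) ?_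
  · intro i a ha
    refine AddSubgroup.iSup_induction (C := fun y => a * y ∈ DN 𝒜 N) _ hy ?_
      (by simp [zero_mem]) ?_
    · intro j b hb
      exact AddSubgroup.mem_iSup_of_mem (⟨(i : G) * (j : G), hN _ i.2 _ j.2⟩ : N)
        (hG.mul_mem ha hb)
    · intro u v hu hv; rw [mul_add]; exact add_mem hu hv
  · intro u v hu hv; rw [add_mul]; exact add_mem hu hv

/-- `D_N` as a subring of `D`, for `N` a subgroup of `G`. -/
def DNsub (𝒜 : G → AddSubgroup D) (hG : IsFaithfulGrading 𝒜) (N : Subgroup G) :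
    Subring D where
  carrier := DN 𝒜 (N : Set G)
  zero_mem' := zero_mem _
  one_mem' := AddSubgroup.mem_iSup_of_mem (⟨1, N.one_mem⟩ : (N : Set G)) hG.one_mem
  add_mem' := fun ha hb => add_mem ha hb
  neg_mem' := fun ha => neg_mem ha
  mul_mem' := fun ha hb => DN_mul_mem 𝒜 hG (fun _ ha _ hb => N.mul_mem ha hb) ha hb

/-- `C`, the centralizer of `D_e` in `D_H`, as a subring of `D`. -/
def Csub (𝒜 : G → AddSubgroup D) (hG : IsFaithfulGrading 𝒜) (H : Subgroup G) :
    Subring D :=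
  Subring.centralizer ((𝒜 1 : AddSubgroup D) : Set D) ⊓ DNsub 𝒜 hG H

lemma Lring_le_Csub (𝒜 : G → AddSubgroup D) (hG : IsFaithfulGrading 𝒜) (H : Subgroup G) :
    Lring 𝒜 hG ≤ Csub 𝒜 hG H := fun x hx => Subring.mem_inf.mpr
  ⟨Subring.mem_centralizer_iff.mpr (fun y hy => (hx.2 y hy).symm),
    AddSubgroup.mem_iSup_of_mem (⟨1, H.one_mem⟩ : ((H : Set G))) hx.1⟩

/-- `dim_L C`, the dimension of the centralizer of `D_e` in `D_H` over `L`. -/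
noncomputable def dimLC (𝒜 : G → AddSubgroup D) (hG : IsFaithfulGrading 𝒜)
    (H : Subgroup G) : ℕ :=
  letI : Module ↥(Lring 𝒜 hG) ↥(Csub 𝒜 hG H) :=
    (Subring.inclusion (Lring_le_Csub 𝒜 hG H)).toModule
  Module.finrank ↥(Lring 𝒜 hG) ↥(Csub 𝒜 hG H)

/-- `L` is a commutative ring. -/
def LcommRing (𝒜 : G → AddSubgroup D) (hG : IsFaithfulGrading 𝒜) :
    CommRing ↥(Lring 𝒜 hG) :=
  { (inferInstance : Ring ↥(Lring 𝒜 hG)) with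
    mul_comm := fun a b => Subtype.ext (by simpa using (b.2.2 a.1 a.2.1).symm) }

lemma De_le_DNsub (𝒜 : G → AddSubgroup D) (hG : IsFaithfulGrading 𝒜) (H : Subgroup G) :
    De 𝒜 hG ≤ DNsub 𝒜 hG H := fun _ hx =>
  AddSubgroup.mem_iSup_of_mem (⟨1, H.one_mem⟩ : ((H : Set G))) hx

lemma Csub_le_DNsub (𝒜 : G → AddSubgroup D) (hG : IsFaithfulGrading 𝒜) (H : Subgroup G) :
    Csub 𝒜 hG H ≤ DNsub 𝒜 hG H := fun _ hx => (Subring.mem_inf.mp hx).2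

section prelim
open scoped TensorProduct

lemma key_indep {E R ι : Type*} [Ring E] [Ring R] (hdiv : ∀ a : E, a ≠ 0 → ∃ b, b * a = 1)
    (i : E →+* R) (b : ι → R) (hcomm : ∀ a k, i a * b k = b k * i a)
    (hind : ∀ (s : Finset ι) (l : ι → E), (∀ k ∈ s, ∀ a, a * l k = l k * a) →
      ∑ k ∈ s, i (l k) * b k = 0 → ∀ k ∈ s, l k = 0) (s : Finset ι) :
    ∀ (e : ι → E), ∑ k ∈ s, i (e k) * b k = 0 → ∀ k ∈ s, e k = 0 := by
  classical
  induction s using Finset.induction_on with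
  | empty => simp
  | insert k0 s hk ih =>
    intro e he
    by_cases h0 : e k0 = 0
    · rw [Finset.sum_insert hk, h0, map_zero, zero_mul, zero_add] at he
      intro k hk'
      rcases Finset.mem_insert.mp hk' with rfl | h
      · exact h0
      · exact ih e he k h
    · exfalso
      obtain ⟨c, hc⟩ := hdiv _ h0
      have hrel : ∑ k ∈ insert k0 s, i (c * e k) * b k = 0 := by
        have := congrArg (fun z => i c * z) he
        simpa [Finset.mul_sum, mul_assoc] using this
      have hcm : ∀ k ∈ insert k0 s, ∀ a, a * (c * e k) = (c * e k) * a := by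
        intro k hk' a
        have h1 : ∑ k ∈ s, i (a * (c * e k) - (c * e k) * a) * b k = 0 := by
          have h2 : ∑ k ∈ insert k0 s, i (a * (c * e k) - (c * e k) * a) * b k = 0 := by
            have h3 := congrArg (fun z => i a * z) hrel
            have h4 := congrArg (fun z => z * i a) hrel
            simp only [Finset.mul_sum, Finset.sum_mul, mul_zero, zero_mul] at h3 h4
            rw [← sub_eq_zero.mpr (h3.trans h4.symm), ← Finset.sum_sub_distrib]
            refine Finset.sum_congr rfl fun k _ => ?_
            rw [map_sub, sub_mul, map_mul i a, map_mul i _ a, mul_assoc (i (c * e k)), hcomm,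
              mul_assoc, mul_assoc]
          rw [Finset.sum_insert hk, hc, mul_one, one_mul, sub_self, map_zero, zero_mul,
            zero_add] at h2
          exact h2
        rcases Finset.mem_insert.mp hk' with rfl | h
        · rw [hc, mul_one, one_mul]
        · exact sub_eq_zero.mp (ih _ h1 k h)
      have := hind _ (fun k => c * e k) hcm hrel k0 (Finset.mem_insert_self _ _)
      simp only [hc] at this
      apply h0
      rw [← one_mul (e k0), this, zero_mul]

lemma tensor_inj {L E C R : Type*} [Field L] [Ring E] [Algebra L E] [AddCommGroup C] [Module L C]
    [Ring R] (hdiv : ∀ a : E, a ≠ 0 → ∃ b, b * a = 1)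
    (hcent : ∀ z : E, (∀ a, a * z = z * a) → ∃ l : L, algebraMap L E l = z)
    (i : E →+* R) (j : C →+ R) (hcomm : ∀ a c, i a * j c = j c * i a)
    (hij : ∀ (l : L) c, j (l • c) = i (algebraMap L E l) * j c)
    (hj : Function.Injective j)
    (f : E ⊗[L] C →+ R) (hf : ∀ a c, f (a ⊗ₜ c) = i a * j c) : Function.Injective f := by
  classical
  rw [injective_iff_map_eq_zero]
  intro t ht
  let b := Module.Free.chooseBasis L C
  obtain ⟨e, rfl⟩ := (TensorProduct.equivFinsuppOfBasisRight (M := E) b).symm.surjective t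
  rw [TensorProduct.equivFinsuppOfBasisRight_symm_apply] at ht
  rw [Finsupp.sum, map_sum] at ht
  simp only [hf] at ht
  have := key_indep hdiv i (fun k => j (b k)) (fun a k => hcomm a _) (by
    intro s l hl hsum k hk
    choose! m hm using fun k hk => hcent (l k) (hl k hk)
    have h1 : j (∑ k ∈ s, m k • b k) = 0 := by
      rw [map_sum, ← hsum]
      exact Finset.sum_congr rfl fun k hk => by rw [hij, hm k hk]
    have h2 := (injective_iff_map_eq_zero j).mp hj _ h1
    rw [← hm k hk, linearIndependent_iff'.mp b.linearIndependent s m h2 k hk, map_zero])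
    _ _ ht
  have he : e = 0 := by
    ext k
    by_contra h
    exact h (this k (Finsupp.mem_support_iff.mpr h))
  rw [he, map_zero]

lemma skolem_noether {L E : Type*} [Field L] [Ring E] [Nontrivial E] [Algebra L E]
    [Module.Finite L E]
    (hdiv : ∀ a : E, a ≠ 0 → ∃ b, b * a = 1)
    (hcent : ∀ z : E, (∀ a, a * z = z * a) → ∃ l : L, algebraMap L E l = z)
    (φ : E →ₐ[L] E) : ∃ u : E, u ≠ 0 ∧ ∀ a, φ a * u = u * a := by
  classical
  let M := AlgHom.mulLeftRight L E
  have hinj : Function.Injective M := by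
    refine tensor_inj (L := L) (E := E) (C := Eᵐᵒᵖ) (R := Module.End L E) hdiv hcent
      (Algebra.lmul L E : E →+* Module.End L E)
      ((LinearMap.mul L E).flip.toAddMonoidHom.comp
        (MulOpposite.opAddEquiv (α := E)).symm.toAddMonoidHom) ?_ ?_ ?_ (M : _ →+ _) ?_
    · intro a c; ext x; simp [mul_assoc]
    · intro l c; ext x; simp [Algebra.smul_def, Algebra.commutes, mul_assoc]
    · intro c d h
      have := congrArg (fun g : Module.End L E => g 1) h
      simpa using this
    · intro a c; ext x; simp [M, mul_assoc]
  have hsurj : Function.Surjective M := by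
    have : Module.Finite L Eᵐᵒᵖ := Module.Finite.equiv (MulOpposite.opLinearEquiv L (M := E))
    refine (LinearMap.injective_iff_surjective_of_finrank_eq_finrank (f := M.toLinearMap) ?_).mp hinj
    rw [Module.finrank_tensorProduct, Module.finrank_linearMap,
      (MulOpposite.opLinearEquiv L (M := E)).finrank_eq]
  obtain ⟨t, ht⟩ := hsurj φ.toLinearMap
  have ht0 : t ≠ 0 := by
    rintro rfl
    have := congrArg (fun g : Module.End L E => g 1) ht
    simp at this
  have hrel : ∀ c, t * (c ⊗ₜ 1) = (φ c ⊗ₜ 1) * t := by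
    intro c
    apply hinj
    rw [map_mul, map_mul, ht]
    ext x
    simp [M]
  let b := Module.Free.chooseBasis L Eᵐᵒᵖ
  let Q := TensorProduct.equivFinsuppOfBasisRight (M := E) b
  have hQ : Q t ≠ 0 := by simpa using ht0
  obtain ⟨k, hk⟩ := Finsupp.ne_iff.mp hQ
  refine ⟨Q t k, hk, fun c => ?_⟩
  have h1 : ∀ s : E ⊗[L] Eᵐᵒᵖ, Q (s * (c ⊗ₜ 1)) k = Q s k * c := by
    intro s
    induction s with
    | zero => simp
    | tmul x y => simp [Q]
    | add x y hx hy => simp [add_mul, hx, hy]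
  have h2 : ∀ (d : E) (s : E ⊗[L] Eᵐᵒᵖ), Q ((d ⊗ₜ 1) * s) k = d * Q s k := by
    intro d s
    induction s with
    | zero => simp
    | tmul x y => simp [Q]
    | add x y hx hy => simp [mul_add, hx, hy]
  rw [← h1, ← h2, hrel]

lemma fin_dim {L E D : Type*} [Field L] [Ring E] [Algebra L E] [DivisionRing D]
    [Module.Finite ↥(Subring.center D) D]
    (hdiv : ∀ a : E, a ≠ 0 → ∃ b, b * a = 1)
    (hcent : ∀ z : E, (∀ a, a * z = z * a) → ∃ l : L, algebraMap L E l = z)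
    (i : E →+* D) : Module.Finite L E := by
  classical
  letI : Module L D := Module.compHom D (i.comp (algebraMap L E))
  have hsm : ∀ (l : L) (d : D), l • d = i (algebraMap L E l) * d := fun _ _ => rfl
  let C : Submodule L D :=
    { carrier := {d | ∀ a, i a * d = d * i a}
      zero_mem' := by intro a; simp
      add_mem' := by intro x y hx hy a; rw [mul_add, add_mul, hx, hy]
      smul_mem' := by
        intro l x hx a
        rw [hsm, ← mul_assoc, ← map_mul, ← Algebra.commutes, map_mul, mul_assoc, hx, mul_assoc] }
  let f : E ⊗[L] C →ₗ[L] D := TensorProduct.lift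
    (LinearMap.mk₂ L (fun (a : E) (c : C) => i a * (c : D))
      (by intros; simp [add_mul])
      (by intros; simp [hsm, Algebra.smul_def, mul_assoc])
      (by intros; simp [mul_add])
      (by intro l a c
          simp only [Submodule.coe_smul, hsm, ← mul_assoc, ← map_mul]
          rw [Algebra.commutes]))
  have hinj : Function.Injective f := tensor_inj (L := L) (C := C) hdiv hcent i
    C.subtype.toAddMonoidHom (fun a c => c.2 a) (fun l c => rfl) Subtype.val_injective
    f.toAddMonoidHom (fun a c => by simp [f])
  let B := Module.Free.chooseBasis L E
  have hli : LinearIndependent (Subring.center D) (fun k => i (B k)) := by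
    rw [linearIndependent_iff']
    intro s g hg
    have hgC : ∀ k, (g k : D) ∈ C := fun k a => Subring.mem_center_iff.mp (g k).2 (i a)
    have h0 : ∑ k ∈ s, B k ⊗ₜ[L] (⟨g k, hgC k⟩ : C) = 0 := by
      apply hinj
      rw [map_sum, map_zero, ← hg]
      refine Finset.sum_congr rfl fun k _ => ?_
      simp only [f, TensorProduct.lift.tmul, LinearMap.mk₂_apply]
      rw [hgC k]; rfl
    intro k hk
    have h1 := congrArg (fun t => TensorProduct.equivFinsuppOfBasisLeft (N := C) B t k) h0
    simp only [map_sum, map_zero, Finsupp.coe_zero, Pi.zero_apply, Finsupp.finsetSum_apply] at h1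
    rw [Finset.sum_eq_single k] at h1
    · simp at h1
      exact h1
    · intro l _ hl
      simp [hl]
    · exact fun h => absurd hk h
  have := hli.finite
  exact Module.Finite.of_basis B

lemma exists_field {L : Type*} [inst : CommRing L] (hL : IsField L) :
    ∃ F : Field L, F.toCommRing = inst := ⟨hL.toField, rfl⟩

lemma tensor_inj' {L E C R : Type*} [inst : CommRing L] (hL : IsField L) [Ring E] [Algebra L E]
    [AddCommGroup C] [Module L C]
    [Ring R] (hdiv : ∀ a : E, a ≠ 0 → ∃ b, b * a = 1)
    (hcent : ∀ z : E, (∀ a, a * z = z * a) → ∃ l : L, algebraMap L E l = z)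
    (i : E →+* R) (j : C →+ R) (hcomm : ∀ a c, i a * j c = j c * i a)
    (hij : ∀ (l : L) c, j (l • c) = i (algebraMap L E l) * j c)
    (hj : Function.Injective j)
    (f : E ⊗[L] C →+ R) (hf : ∀ a c, f (a ⊗ₜ c) = i a * j c) : Function.Injective f := by
  obtain ⟨F, rfl⟩ := exists_field hL
  exact tensor_inj hdiv hcent i j hcomm hij hj f hf

lemma skolem_noether' {L E D : Type*} [inst : CommRing L] (hL : IsField L) [Ring E] [Nontrivial E]
    [Algebra L E] [DivisionRing D] [Module.Finite ↥(Subring.center D) D]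
    (hdiv : ∀ a : E, a ≠ 0 → ∃ b, b * a = 1)
    (hcent : ∀ z : E, (∀ a, a * z = z * a) → ∃ l : L, algebraMap L E l = z)
    (i : E →+* D) (φ : E →ₐ[L] E) : ∃ u : E, u ≠ 0 ∧ ∀ a, φ a * u = u * a := by
  obtain ⟨F, rfl⟩ := exists_field hL
  have := fin_dim hdiv hcent i
  exact skolem_noether hdiv hcent φ

section graded

/-- Homogeneous projections. -/
lemma exists_proj [Finite G] (𝒜 : G → AddSubgroup D) (hG : IsFaithfulGrading 𝒜) :
    ∃ p : G → D →+ D, (∀ g x, p g x ∈ 𝒜 g) ∧ (∀ g, ∀ x ∈ 𝒜 g, p g x = x) ∧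
      (∀ g h, g ≠ h → ∀ x ∈ 𝒜 h, p g x = 0) ∧
      (∀ (s : Finset G), (∀ g, g ∈ s) → ∀ x, ∑ g ∈ s, p g x = x) := by
  classical
  let e : DirectSum G (fun g => 𝒜 g) ≃+ D := AddEquiv.ofBijective _ hG.isInternal
  have he : ∀ g (x : 𝒜 g), e (DirectSum.of (fun g => 𝒜 g) g x) = x := fun g x =>
    DirectSum.coeAddMonoidHom_of 𝒜 g x
  have he' : ∀ g (x : D) (hx : x ∈ 𝒜 g), e.symm x = DirectSum.of (fun g => 𝒜 g) g ⟨x, hx⟩ := by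
    intro g x hx
    rw [AddEquiv.symm_apply_eq, he]
  refine ⟨fun g => (𝒜 g).subtype.comp
    ((DFinsupp.evalAddMonoidHom g).comp e.symm.toAddMonoidHom), ?_, ?_, ?_, ?_⟩
  · intro g x; exact SetLike.coe_mem _
  · intro g x hx
    change ((e.symm x g : 𝒜 g) : D) = x
    rw [he' g x hx, DirectSum.of_eq_same]
  · intro g h hgh x hx
    change ((e.symm x g : 𝒜 g) : D) = 0
    rw [he' h x hx, DirectSum.of_eq_of_ne _ _ _ hgh]; rfl
  · intro s hs x
    change ∑ g ∈ s, ((e.symm x g : 𝒜 g) : D) = x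
    conv_rhs => rw [← e.apply_symm_apply x]
    generalize e.symm x = y
    induction y using DirectSum.induction_on with
    | zero => simp
    | of g x =>
      rw [he, Finset.sum_eq_single g, DirectSum.of_eq_same]
      · intro b _ hb
        rw [DirectSum.of_eq_of_ne _ _ _ hb]; rfl
      · exact fun h => absurd (hs g) h
    | add x y hx hy =>
      rw [map_add, ← hx, ← hy, ← Finset.sum_add_distrib]
      exact Finset.sum_congr rfl fun g _ => rfl

end graded

end prelim

open scoped TensorProduct in
/-- Under the standing hypotheses: every `h ∈ H` has a nonzero
representative in `D_h` commuting with all of `D_e`; with `C` the centralizer of `D_e`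
in `D_H`, each `C ∩ D_h` is a one-dimensional left `L`-space, `C = ⊕_{h ∈ H} (C ∩ D_h)`,
and the multiplication map `D_e ⊗_L C → D_H` is an isomorphism of `L`-algebras. -/
theorem DH_tensor_decomposition
    [Finite G] [CharZero D]
    (𝒜 : G → AddSubgroup D) (hG : IsFaithfulGrading 𝒜)
    [Module.Finite ↥(Subring.center D) D]
    (ζ : D) (hζK : ζ ∈ Subring.center D) (hζe : ζ ∈ 𝒜 1)
    (hζ : orderOf ζ = Monoid.exponent G)
    (H : Subgroup G) (hHcar : (H : Set G) = Hset 𝒜) (hHn : H.Normal) :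
    -- for every `h ∈ H` there is a nonzero `x_h ∈ D_h` commuting with all of `D_e`
    (∀ h ∈ H, ∃ x : D, x ≠ 0 ∧ x ∈ 𝒜 h ∧ ∀ a ∈ 𝒜 1, x * a = a * x) ∧
    -- each `C ∩ D_h` is a one-dimensional left `L`-vector space
    (∀ h ∈ H, ∃ x : D, x ≠ 0 ∧ x ∈ Csub 𝒜 hG H ∧ x ∈ 𝒜 h ∧
      ∀ y : D, y ∈ Csub 𝒜 hG H → y ∈ 𝒜 h → ∃ l ∈ Lset 𝒜, y = l * x) ∧
    -- `C = ⊕_{h ∈ H} (C ∩ D_h)`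
    (∀ x : D, x ∈ Csub 𝒜 hG H ↔
      x ∈ ⨆ h : (H : Set G), ((Csub 𝒜 hG H).toAddSubgroup ⊓ 𝒜 (h : G))) ∧
    -- the multiplication map `D_e ⊗_L C → D_H` is an isomorphism of `L`-algebras
    (letI : CommRing ↥(Lring 𝒜 hG) := LcommRing 𝒜 hG
     letI : Algebra ↥(Lring 𝒜 hG) ↥(De 𝒜 hG) :=
       (Subring.inclusion (Lring_le_De 𝒜 hG)).toAlgebra'
         (fun c x => Subtype.ext (c.2.2 x.1 x.2))
     letI : Algebra ↥(Lring 𝒜 hG) ↥(Csub 𝒜 hG H) :=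
       (Subring.inclusion (Lring_le_Csub 𝒜 hG H)).toAlgebra'
         (fun c x => Subtype.ext
           (Subring.mem_centralizer_iff.mp (Subring.mem_inf.mp x.2).1 c.1 c.2.1))
     ∃ f : (↥(De 𝒜 hG) ⊗[↥(Lring 𝒜 hG)] ↥(Csub 𝒜 hG H)) ≃+* ↥(DNsub 𝒜 hG H),
       ∀ (x : ↥(De 𝒜 hG)) (y : ↥(Csub 𝒜 hG H)),
         f (x ⊗ₜ y) = ⟨(x : D) * (y : D),
           Subring.mul_mem _ (De_le_DNsub 𝒜 hG H x.2) (Csub_le_DNsub 𝒜 hG H y.2)⟩) := by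
  classical
  obtain ⟨p, hpm, hps, hpn, hsum⟩ := exists_proj 𝒜 hG
  let _ : Fintype G := Fintype.ofFinite G
  have hsum' : ∀ x, ∑ g, p g x = x := hsum Finset.univ (fun g => Finset.mem_univ g)
  have hpl : ∀ g k x y, x ∈ 𝒜 g → p (g * k) (x * y) = x * p k y := by
    intro g k x y hx
    conv_lhs => rw [← hsum' y, Finset.mul_sum, map_sum]
    rw [Finset.sum_eq_single k]
    · exact hps _ _ (hG.mul_mem hx (hpm _ _))
    · intro b _ hb
      exact hpn _ (g * b) (fun h => hb (mul_left_cancel h).symm) _ (hG.mul_mem hx (hpm _ _))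
    · simp
  have hpr : ∀ g k x y, x ∈ 𝒜 g → p (k * g) (y * x) = p k y * x := by
    intro g k x y hx
    conv_lhs => rw [← hsum' y, Finset.sum_mul, map_sum]
    rw [Finset.sum_eq_single k]
    · exact hps _ _ (hG.mul_mem (hpm _ _) hx)
    · intro b _ hb
      exact hpn _ (b * g) (fun h => hb (mul_right_cancel h).symm) _ (hG.mul_mem (hpm _ _) hx)
    · simp
  have hinv : ∀ g x, x ∈ 𝒜 g → x⁻¹ ∈ 𝒜 g⁻¹ := by
    intro g x hx
    by_cases h0 : x = 0
    · rw [h0, inv_zero]; exact zero_mem _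
    have h1 := hpl g g⁻¹ x x⁻¹ hx
    rw [mul_inv_cancel, mul_inv_cancel₀ h0, hps _ _ hG.one_mem] at h1
    rw [← eq_inv_of_mul_eq_one_right h1.symm]
    exact hpm _ _
  have hinv1 : ∀ x, x ∈ 𝒜 1 → x⁻¹ ∈ 𝒜 1 := fun x hx => by simpa using hinv 1 x hx
  have hHmem : ∀ h ∈ H, ∀ x ∈ 𝒜 h, ∀ l ∈ Lset 𝒜, x * l = l * x := by
    intro h hh
    have : h ∈ Hset 𝒜 := by rw [← hHcar]; exact hh
    exact this
  let _ : CommRing ↥(Lring 𝒜 hG) := LcommRing 𝒜 hG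
  let _ : Algebra ↥(Lring 𝒜 hG) ↥(De 𝒜 hG) :=
       (Subring.inclusion (Lring_le_De 𝒜 hG)).toAlgebra'
         (fun c x => Subtype.ext (c.2.2 x.1 x.2))
  let _ : Algebra ↥(Lring 𝒜 hG) ↥(Csub 𝒜 hG H) :=
       (Subring.inclusion (Lring_le_Csub 𝒜 hG H)).toAlgebra'
         (fun c x => Subtype.ext
           (Subring.mem_centralizer_iff.mp (Subring.mem_inf.mp x.2).1 c.1 c.2.1))
  have hLf : IsField ↥(Lring 𝒜 hG) :=
    { exists_pair_ne := ⟨0, 1, zero_ne_one⟩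
      mul_comm := mul_comm
      mul_inv_cancel := by
        intro a ha
        have ha0 : (a : D) ≠ 0 := fun h => ha (Subtype.ext h)
        refine ⟨⟨(a : D)⁻¹, hinv1 _ a.2.1, fun y hy => ?_⟩, Subtype.ext (mul_inv_cancel₀ ha0)⟩
        exact (Commute.inv_left₀ (a.2.2 y hy : Commute (a : D) y)) }
  have hdiv : ∀ a : ↥(De 𝒜 hG), a ≠ 0 → ∃ b, b * a = 1 := by
    intro a ha
    have ha0 : (a : D) ≠ 0 := fun h => ha (Subtype.ext h)
    exact ⟨⟨(a : D)⁻¹, hinv1 _ a.2⟩, Subtype.ext (inv_mul_cancel₀ ha0)⟩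
  have hcent : ∀ z : ↥(De 𝒜 hG), (∀ a, a * z = z * a) →
      ∃ l : ↥(Lring 𝒜 hG), algebraMap ↥(Lring 𝒜 hG) ↥(De 𝒜 hG) l = z := by
    intro z hz
    exact ⟨⟨z, z.2, fun y hy => (congrArg Subtype.val (hz ⟨y, hy⟩)).symm⟩, rfl⟩
  have P1 : ∀ h ∈ H, ∃ x : D, x ≠ 0 ∧ x ∈ 𝒜 h ∧ ∀ a ∈ 𝒜 1, x * a = a * x := by
    intro h hh
    obtain ⟨⟨x, hx⟩, hx0'⟩ := AddSubgroup.ne_bot_iff_exists_ne_zero.mp (hG.faithful h)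
    have hx0 : x ≠ 0 := fun h => hx0' (Subtype.ext h)
    have hφm : ∀ a : ↥(De 𝒜 hG), x * a * x⁻¹ ∈ De 𝒜 hG := by
      intro a
      have := hG.mul_mem (hG.mul_mem hx a.2) (hinv _ _ hx)
      rwa [mul_one, mul_inv_cancel] at this
    let φ : ↥(De 𝒜 hG) →ₐ[↥(Lring 𝒜 hG)] ↥(De 𝒜 hG) :=
      { toFun := fun a => ⟨x * a * x⁻¹, hφm a⟩
        map_one' := Subtype.ext (by simp [hx0])
        map_mul' := fun a b => Subtype.ext (by simp [mul_assoc, hx0])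
        map_zero' := Subtype.ext (by simp)
        map_add' := fun a b => Subtype.ext (by simp [mul_add, add_mul])
        commutes' := fun l => Subtype.ext (by
          change x * (l : D) * x⁻¹ = (l : D)
          rw [hHmem h hh x hx l l.2, mul_assoc, mul_inv_cancel₀ hx0, mul_one]) }
    obtain ⟨u, hu0, hu⟩ := skolem_noether' hLf hdiv hcent (De 𝒜 hG).subtype φ
    have hu0' : (u : D) ≠ 0 := fun h => hu0 (Subtype.ext h)
    refine ⟨(u : D)⁻¹ * x, mul_ne_zero (inv_ne_zero hu0') hx0, ?_, ?_⟩
    · simpa using hG.mul_mem (hinv1 _ u.2) hx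
    · intro a ha
      have h1 : x * a * x⁻¹ * (u : D) = u * a := congrArg Subtype.val (hu ⟨a, ha⟩)
      have h2 : x * a = u * a * (u : D)⁻¹ * x := by
        rw [← h1]; simp [mul_assoc, hu0', hx0]
      rw [mul_assoc, h2]; simp [mul_assoc, hu0']
  have hCmem : ∀ h ∈ H, ∀ x ∈ 𝒜 h, (∀ a ∈ 𝒜 1, x * a = a * x) → x ∈ Csub 𝒜 hG H := by
    intro h hh x hx hc
    exact Subring.mem_inf.mpr ⟨Subring.mem_centralizer_iff.mpr (fun y hy => (hc y hy).symm),
      AddSubgroup.mem_iSup_of_mem (⟨h, hh⟩ : ((H : Set G))) hx⟩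
  have hCc : ∀ x ∈ Csub 𝒜 hG H, ∀ a ∈ 𝒜 1, x * a = a * x := fun x hx a ha =>
    (Subring.mem_centralizer_iff.mp (Subring.mem_inf.mp hx).1 a ha).symm
  refine ⟨P1, ?_, ?_, ?_⟩
  · intro h hh
    obtain ⟨x, hx0, hx, hxc⟩ := P1 h hh
    refine ⟨x, hx0, hCmem h hh x hx hxc, hx, fun y hyC hy => ?_⟩
    refine ⟨y * x⁻¹, ⟨?_, ?_⟩, by rw [mul_assoc, inv_mul_cancel₀ hx0, mul_one]⟩
    · simpa using hG.mul_mem hy (hinv _ _ hx)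
    · intro a ha
      have h1 : Commute x⁻¹ a := Commute.inv_left₀ (hxc a ha)
      have h2 : Commute y a := hCc y hyC a ha
      exact h2.mul_left h1
  · intro x
    constructor
    · intro hx
      rw [← hsum' x]
      refine sum_mem fun g _ => ?_
      by_cases hg : g ∈ H
      · refine AddSubgroup.mem_iSup_of_mem (⟨g, hg⟩ : ((H : Set G))) ⟨?_, hpm _ _⟩
        refine hCmem g hg _ (hpm _ _) fun a ha => ?_
        have h1 := hpl 1 g a x ha
        have h2 := hpr 1 g a x ha
        rw [one_mul] at h1
        rw [mul_one] at h2
        rw [← h1, ← h2, hCc x hx a ha]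
      · have : p g x = 0 := by
          refine AddSubgroup.iSup_induction (C := fun x => p g x = 0) _ (Csub_le_DNsub 𝒜 hG H hx)
            ?_ (map_zero _) ?_
          · intro k y hy
            exact hpn g k (fun h => hg (h ▸ k.2)) y hy
          · intro u v hu hv; rw [map_add, hu, hv, add_zero]
        rw [this]; exact zero_mem _
    · intro hx
      have : (⨆ h : (H : Set G), ((Csub 𝒜 hG H).toAddSubgroup ⊓ 𝒜 (h : G)))
          ≤ (Csub 𝒜 hG H).toAddSubgroup := iSup_le fun _ => inf_le_left
      exact this hx
  · have hLD : Lring 𝒜 hG ≤ DNsub 𝒜 hG H := (Lring_le_De 𝒜 hG).trans (De_le_DNsub 𝒜 hG H)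
    let _ : Algebra ↥(Lring 𝒜 hG) ↥(DNsub 𝒜 hG H) :=
      (Subring.inclusion hLD).toAlgebra' (fun c x => Subtype.ext (by
        change (c : D) * (x : D) = x * c
        refine AddSubgroup.iSup_induction (C := fun x => (c : D) * x = x * c) _ x.2 ?_ ?_ ?_
        · intro k y hy; exact (hHmem k k.2 y hy c c.2).symm
        · simp
        · intro u v hu hv; rw [mul_add, add_mul, hu, hv]))
    let i : ↥(De 𝒜 hG) →ₐ[↥(Lring 𝒜 hG)] ↥(DNsub 𝒜 hG H) :=
      { Subring.inclusion (De_le_DNsub 𝒜 hG H) with commutes' := fun l => rfl }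
    let j : ↥(Csub 𝒜 hG H) →ₐ[↥(Lring 𝒜 hG)] ↥(DNsub 𝒜 hG H) :=
      { Subring.inclusion (Csub_le_DNsub 𝒜 hG H) with commutes' := fun l => rfl }
    have hij : ∀ a c, Commute (i a) (j c) := fun a c =>
      Subtype.ext (hCc c c.2 a a.2).symm
    let f := Algebra.TensorProduct.lift i j hij
    have hf : ∀ a c, f (a ⊗ₜ c) = i a * j c := fun a c => Algebra.TensorProduct.lift_tmul ..
    have hfi : Function.Injective f.toRingHom.toAddMonoidHom :=
      tensor_inj' hLf hdiv hcent i.toRingHom j.toRingHom.toAddMonoidHom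
        (fun a c => hij a c) (fun l c => rfl)
        (Subring.inclusion_injective (Csub_le_DNsub 𝒜 hG H)) f.toRingHom.toAddMonoidHom hf
    have hfs : Function.Surjective f := by
      have hr : ∀ d ∈ DN 𝒜 (H : Set G), ∃ t, (f t : D) = d := by
        intro d hd
        refine AddSubgroup.iSup_induction (C := fun d => ∃ t, (f t : D) = d) _ hd ?_ ?_ ?_
        · intro k y hy
          obtain ⟨x, hx0, hx, hxc⟩ := P1 k k.2
          have hm : y * x⁻¹ ∈ De 𝒜 hG := by
            have := hG.mul_mem hy (hinv _ _ hx)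
            rwa [mul_inv_cancel] at this
          refine ⟨(⟨y * x⁻¹, hm⟩ : ↥(De 𝒜 hG)) ⊗ₜ
            (⟨x, hCmem k k.2 x hx hxc⟩ : ↥(Csub 𝒜 hG H)), ?_⟩
          rw [hf]
          change y * x⁻¹ * x = y
          rw [mul_assoc, inv_mul_cancel₀ hx0, mul_one]
        · exact ⟨0, by simp⟩
        · rintro u v ⟨s, rfl⟩ ⟨t, rfl⟩
          exact ⟨s + t, by simp⟩
      intro d
      obtain ⟨t, ht⟩ := hr d d.2
      exact ⟨t, Subtype.ext ht⟩
    exact ⟨RingEquiv.ofBijective f ⟨hfi, hfs⟩, fun a c => hf a c⟩
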